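/- Let m > 1 and y_0 ∈ ℝ^k with y_0 ≠ 0. Then the function Y(t) = (y_0/|y_0|) · ( 1/((m−1)t + |y_0|^{1−m}) )^{1/(m−1)} is the solution on [0,1] of the ordinary differential equation Y'(t) = −|Y(t)|^{m−1} Y(t) with Y(0) = y_0, and there is a constant C(m) ≥ 1 depending only on m such that for all t ∈ (0,1]: (1/C(m)) · min{ |y_0|, t^{−1/(m−1)} } ≤ |Y(t)| ≤ C(m) · min{ |y_0|, t^{−1/(m−1)} }. -/

import Mathlib

noncomputable section

lemma rpow_neg_max {a b p : ℝ} (ha : 0 < a) (hb : 0 < b) (hp : 0 ≤ p) :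
    (max a b) ^ (-p) = min (a ^ (-p)) (b ^ (-p)) := by
  rcases le_total a b with h | h
  · rw [max_eq_right h,
      min_eq_right (Real.rpow_le_rpow_of_nonpos ha h (neg_nonpos.mpr hp))]
  · rw [max_eq_left h,
      min_eq_left (Real.rpow_le_rpow_of_nonpos hb h (neg_nonpos.mpr hp))]

/-- The scalar profile `(c t + a)^{-1/c}` solves `y' = -y^c y`. -/
lemma hasDerivAt_one_div_affine_rpow {c a t : ℝ} (hc : 0 < c) (h : 0 < c * t + a) :
    HasDerivAt (fun s : ℝ => (1 / (c * s + a)) ^ (1 / c))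
      (-(((1 / (c * t + a)) ^ (1 / c)) ^ c * (1 / (c * t + a)) ^ (1 / c))) t := by
  have hd : HasDerivAt (fun s : ℝ => 1 / (c * s + a)) (-c / (c * t + a) ^ 2) t := by
    have h1 : HasDerivAt (fun s : ℝ => c * s + a) c t := by
      simpa using ((hasDerivAt_id t).const_mul c).add_const a
    simpa only [one_div] using h1.fun_inv h.ne'
  have hpos : 0 < 1 / (c * t + a) := one_div_pos.mpr h
  convert hd.rpow_const (p := 1 / c) (Or.inl hpos.ne') using 1
  rw [← Real.rpow_mul hpos.le, one_div_mul_cancel hc.ne', Real.rpow_one,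
    Real.rpow_sub_one hpos.ne']
  field_simp

/-- Two-sided comparison of `(c t + a)^{-1/c}` with `min (a^{-1/c}) (t^{-1/c})`. -/
lemma one_div_affine_rpow_bounds {c a t : ℝ} (hc : 0 < c) (ha : 0 < a) (ht : 0 < t) :
    ((max (c + 1) c⁻¹) ^ (1 / c))⁻¹ * min (a ^ (-(1 / c))) (t ^ (-(1 / c)))
        ≤ (1 / (c * t + a)) ^ (1 / c) ∧
      (1 / (c * t + a)) ^ (1 / c)
        ≤ (max (c + 1) c⁻¹) ^ (1 / c) * min (a ^ (-(1 / c))) (t ^ (-(1 / c))) := by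
  set K := max (c + 1) c⁻¹
  have hK1 : c + 1 ≤ K := le_max_left _ _
  have hK : 0 < K := by linarith
  have hKc : 1 ≤ K * c := by
    have := mul_le_mul_of_nonneg_right (le_max_right (c + 1) c⁻¹) hc.le
    rwa [inv_mul_cancel₀ hc.ne'] at this
  have hp : 0 ≤ 1 / c := (one_div_pos.mpr hc).le
  have hD : 0 < c * t + a := by positivity
  have hM : 0 < max a t := lt_max_of_lt_left ha
  have hupper : c * t + a ≤ K * max a t := by
    have h1 := mul_le_mul_of_nonneg_left (le_max_right a t) hc.le
    have h2 := mul_le_mul_of_nonneg_right hK1 hM.le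
    linarith [le_max_left a t]
  have hlower : max a t ≤ K * (c * t + a) := by
    have h1 := mul_le_mul_of_nonneg_right hKc ht.le
    have h2 : 1 * a ≤ K * a := mul_le_mul_of_nonneg_right (by linarith) ha.le
    have h3 := mul_pos hK ha
    have h4 := mul_pos (mul_pos hK hc) ht
    exact max_le (by linarith) (by linarith)
  rw [← rpow_neg_max ha ht hp, Real.rpow_neg hM.le, ← Real.inv_rpow hM.le,
    ← Real.inv_rpow hK.le, ← Real.mul_rpow (by positivity) (by positivity),
    ← Real.mul_rpow (by positivity) (by positivity)]
  constructor
  · refine Real.rpow_le_rpow (by positivity) ?_ hp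
    rw [← mul_inv, ← one_div]
    exact one_div_le_one_div_of_le hD hupper
  · refine Real.rpow_le_rpow (by positivity) ?_ hp
    rw [← div_eq_mul_inv, div_le_div_iff₀ hD hM, one_mul]
    exact hlower

/-- **Remark 1.6.** The explicit function
`Y(t) = (y₀/|y₀|) (1/((m−1)t + |y₀|^{1−m}))^{1/(m−1)}` solves
`Y' = −|Y|^{m−1}Y`, `Y(0) = y₀`, on `[0,1]`, and satisfies
`C(m)⁻¹ min{|y₀|, t^{−1/(m−1)}} ≤ |Y(t)| ≤ C(m) min{|y₀|, t^{−1/(m−1)}}`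
for all `t ∈ (0,1]`, for some constant `C(m) ≥ 1` depending only on `m`. -/
theorem explicit_ODE_solution (k : ℕ) (m : ℝ) (hm : 1 < m) :
    ∃ C : ℝ, 1 ≤ C ∧
      ∀ y0 : EuclideanSpace ℝ (Fin k), y0 ≠ 0 →
      let Y : ℝ → EuclideanSpace ℝ (Fin k) :=
        fun t => ((1 / ((m - 1) * t + ‖y0‖ ^ (1 - m))) ^ (1 / (m - 1))) • (‖y0‖⁻¹ • y0)
      (Y 0 = y0) ∧
      (∀ t ∈ Set.Icc (0:ℝ) 1, HasDerivAt Y (-((‖Y t‖ ^ (m - 1)) • Y t)) t) ∧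
      ∀ t ∈ Set.Ioc (0:ℝ) 1,
        C⁻¹ * min ‖y0‖ (t ^ (-(1 / (m - 1)))) ≤ ‖Y t‖ ∧
        ‖Y t‖ ≤ C * min ‖y0‖ (t ^ (-(1 / (m - 1)))) := by
  have hc : 0 < m - 1 := sub_pos.mpr hm
  refine ⟨(max ((m - 1) + 1) (m - 1)⁻¹) ^ (1 / (m - 1)),
    Real.one_le_rpow (le_max_of_le_left (by linarith)) (one_div_pos.mpr hc).le, ?_⟩
  intro y0 hy0 Y
  have hr : 0 < ‖y0‖ := norm_pos_iff.mpr hy0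
  have ha : 0 < ‖y0‖ ^ (1 - m) := Real.rpow_pos_of_pos hr _
  have hroot : (‖y0‖ ^ (1 - m)) ^ (-(1 / (m - 1))) = ‖y0‖ := by
    rw [← Real.rpow_mul hr.le,
      show (1 - m) * -(1 / (m - 1)) = 1 by field_simp; ring, Real.rpow_one]
  have hD : ∀ t : ℝ, 0 ≤ t → 0 < (m - 1) * t + ‖y0‖ ^ (1 - m) := fun t ht => by positivity
  have hnorm : ∀ t : ℝ, 0 ≤ t →
      ‖Y t‖ = (1 / ((m - 1) * t + ‖y0‖ ^ (1 - m))) ^ (1 / (m - 1)) := by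
    intro t ht
    have := hD t ht
    rw [norm_smul, norm_smul, norm_inv, norm_norm, inv_mul_cancel₀ hr.ne', mul_one,
      Real.norm_of_nonneg (by positivity)]
  refine ⟨?_, ?_, ?_⟩
  · simp only [Y, mul_zero, zero_add]
    rw [one_div (‖y0‖ ^ (1 - m)), Real.inv_rpow ha.le, ← Real.rpow_neg ha.le, hroot,
      smul_inv_smul₀ hr.ne']
  · rintro t ⟨ht, -⟩
    rw [hnorm t ht]
    have h := (hasDerivAt_one_div_affine_rpow hc (hD t ht)).smul_const (‖y0‖⁻¹ • y0)
    rw [neg_smul, mul_smul] at h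
    exact h
  · rintro t ⟨ht, -⟩
    rw [hnorm t ht.le]
    simpa only [hroot] using one_div_affine_rpow_bounds hc ha ht

end
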